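/- Let d ≥ 1, m ≥ 1 and Λ > 0. For every C > 0 there exist b > 0 and ε₀ > 0 such that for every ε ∈ (0, ε₀), every point P ∈ ℝ^m, and every mild solution u : ℝ^d × (0,∞) → ℝ^m of the harmonic map heat flow with initial data u₀ and forcing bound Λ, where u₀ satisfies ‖u₀ - P‖_{L^∞} + ‖∇u₀‖_{L^∞} ≤ ε and where ‖u(t) - P‖_{L^∞} and (1+t)^{1/2}‖∇u(t)‖_{L^∞} depend continuously on t ∈ [0,∞), one has sup_{t ∈ [0, exp(b/ε) - 1]} ‖u(t) - P‖_{L^∞(ℝ^d)} + sup_{t ∈ [0, exp(b/ε) - 1]} (1+t)^{1/2} ‖∇u(t)‖_{L^∞(ℝ^d)} ≤ C. -/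

import Mathlib

noncomputable section

open MeasureTheory Real Set Filter
open scoped ENNReal

/-- `ℝ^d` as a Euclidean space. -/
abbrev Ed (d : ℕ) : Type := EuclideanSpace ℝ (Fin d)

/-- The heat kernel `G(x,t) = (4πt)^{-d/2} e^{-|x|²/(4t)}` on `ℝ^d`. -/
def heatKernel (d : ℕ) (t : ℝ) (x : Ed d) : ℝ :=
  (4 * Real.pi * t) ^ (-(d : ℝ) / 2) * Real.exp (-‖x‖ ^ 2 / (4 * t))

/-- Heat extension `G(t) f = G(·,t) ⋆ f`. -/
def heatConv {F : Type} [NormedAddCommGroup F] [NormedSpace ℝ F] (d : ℕ) (t : ℝ)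
    (v : Ed d → F) : Ed d → F :=
  fun x => ∫ y, heatKernel d t (x - y) • v y

/-- `u : ℝ^d × (0,∞) → ℝ^m` (time variable first) is a mild solution of the harmonic map
heat flow with initial data `u₀` and forcing bound `Λ`. -/
def IsMildSolution (d m : ℕ) (Λ : ℝ) (u₀ : Ed d → Ed m) (u : ℝ → Ed d → Ed m) : Prop :=
  ∃ f : ℝ → Ed d → Ed m,
    Measurable (Function.uncurry f) ∧
    (∀ s : ℝ, 0 < s → ∀ x : Ed d, ‖f s x‖ ≤ Λ * ‖fderiv ℝ (u s) x‖ ^ 2) ∧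
    (∀ t : ℝ, 0 < t → ∀ x : Ed d,
      u t x = heatConv d t u₀ x + ∫ s in Set.Ioo (0 : ℝ) t, heatConv d (t - s) (f s) x)

/-- The constant in the `L¹` Lipschitz bound for translates of the heat kernel. -/
def kernelLipConst (d : ℕ) : ℝ := 3 * 2 ^ ((d : ℝ) / 2)

lemma kernelLipConst_pos (d : ℕ) : 0 < kernelLipConst d := by
  unfold kernelLipConst; positivity

lemma heatKernel_nonneg (d : ℕ) {t : ℝ} (ht : 0 < t) (x : Ed d) : 0 ≤ heatKernel d t x := by
  unfold heatKernel; positivity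

lemma heatKernel_pos (d : ℕ) {t : ℝ} (ht : 0 < t) (x : Ed d) : 0 < heatKernel d t x := by
  unfold heatKernel; positivity

lemma continuous_heatKernel (d : ℕ) (t : ℝ) : Continuous (heatKernel d t) := by
  unfold heatKernel; fun_prop

lemma measurable_heatKernel_uncurry (d : ℕ) :
    Measurable fun p : ℝ × Ed d => heatKernel d p.1 p.2 := by
  unfold heatKernel; fun_prop

lemma integral_heatKernel (d : ℕ) {t : ℝ} (ht : 0 < t) : ∫ x, heatKernel d t x = 1 := by
  have h := GaussianFourier.integral_rexp_neg_mul_sq_norm (V := Ed d)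
    (b := 1 / (4 * t)) (by positivity)
  have e : ∀ x : Ed d, -‖x‖ ^ 2 / (4 * t) = -(1 / (4 * t)) * ‖x‖ ^ 2 := fun x => by ring
  simp only [heatKernel, e]
  rw [integral_const_mul, h, finrank_euclideanSpace_fin,
    show π / (1 / (4 * t)) = 4 * π * t by field_simp, ← Real.rpow_add (by positivity)]
  simp [neg_div]

lemma integrable_heatKernel (d : ℕ) {t : ℝ} (ht : 0 < t) : Integrable (heatKernel d t) := by
  by_contra h
  have := integral_heatKernel d ht
  rw [integral_undef h] at this
  exact zero_ne_one this

lemma integrable_heatKernel_sub (d : ℕ) {t : ℝ} (ht : 0 < t) (x : Ed d) :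
    Integrable fun y => heatKernel d t (x - y) :=
  (integrable_heatKernel d ht).comp_sub_left x

lemma integral_heatKernel_sub (d : ℕ) {t : ℝ} (ht : 0 < t) (x : Ed d) :
    ∫ y, heatKernel d t (x - y) = 1 := by
  rw [integral_sub_left_eq_self (fun y => heatKernel d t y), integral_heatKernel d ht]

/-- Completing the square in a product of two heat kernels. -/
lemma heatKernel_mul_heatKernel (d : ℕ) {t s : ℝ} (ht : 0 < t) (hs : 0 < s) (x y : Ed d) :
    heatKernel d t (x - y) * heatKernel d s y =
      heatKernel d (t + s) x * heatKernel d (t * s / (t + s)) ((s / (t + s)) • x - y) := by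
  have hts : 0 < t + s := add_pos ht hs
  unfold heatKernel
  rw [mul_mul_mul_comm ((4 * π * t) ^ _), mul_mul_mul_comm ((4 * π * (t + s)) ^ _), ← Real.mul_rpow (by positivity) (by positivity),
    ← Real.mul_rpow (by positivity) (by positivity), ← Real.exp_add, ← Real.exp_add]
  congr 2
  · field_simp
  · have h1 : ‖x - y‖ ^ 2 = ‖x‖ ^ 2 - 2 * inner ℝ x y + ‖y‖ ^ 2 := norm_sub_sq_real x y
    have h2 : ‖(s / (t + s)) • x - y‖ ^ 2 =
        (s / (t + s)) ^ 2 * ‖x‖ ^ 2 - 2 * ((s / (t + s)) * inner ℝ x y) + ‖y‖ ^ 2 := by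
      rw [norm_sub_sq_real, norm_smul, mul_pow, inner_smul_left, Real.norm_eq_abs, sq_abs]
      simp
    rw [h1, h2]
    field_simp
    ring

lemma integral_heatKernel_mul_heatKernel (d : ℕ) {t s : ℝ} (ht : 0 < t) (hs : 0 < s)
    (x z : Ed d) :
    ∫ y, heatKernel d t (x - y) * heatKernel d s (y - z) = heatKernel d (t + s) (x - z) := by
  rw [← integral_add_right_eq_self _ z]
  simp only [add_sub_cancel_right, ← sub_sub, sub_right_comm x _ z]
  simp only [heatKernel_mul_heatKernel d ht hs (x - z)]
  rw [integral_const_mul, integral_heatKernel_sub d (by positivity), mul_one]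

lemma abs_exp_neg_sq_sub_le {p q : ℝ} (hp : 0 ≤ p) (hpq : p ≤ q) :
    |Real.exp (-p ^ 2) - Real.exp (-q ^ 2)| ≤ 3 * (q - p) * Real.exp (-p ^ 2 / 2) := by
  have hmono : Real.exp (-q ^ 2) ≤ Real.exp (-p ^ 2) := Real.exp_le_exp.2 (by nlinarith)
  rw [abs_of_nonneg (by linarith)]
  set E := Real.exp (-p ^ 2 / 2) with hE
  have hE0 : 0 < E := Real.exp_pos _
  have hEE : Real.exp (-p ^ 2) = E * E := by rw [hE, ← Real.exp_add]; ring_nf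
  have hE1 : E * (1 + p ^ 2 / 2) ≤ 1 := by
    have h1 : p ^ 2 / 2 + 1 ≤ Real.exp (p ^ 2 / 2) := Real.add_one_le_exp _
    have h2 : E * Real.exp (p ^ 2 / 2) = 1 := by
      rw [hE, ← Real.exp_add]; ring_nf; simp
    nlinarith
  have hE2 : E ≤ 1 := by nlinarith [mul_nonneg hE0.le (sq_nonneg p)]
  rcases le_total 1 (q - p) with h | h
  · have : 0 < Real.exp (-q ^ 2) := Real.exp_pos _
    rw [hEE]
    nlinarith
  · have hq : Real.exp (-q ^ 2) = Real.exp (-p ^ 2) * Real.exp (-(q ^ 2 - p ^ 2)) := by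
      rw [← Real.exp_add]; ring_nf
    have h3 : -(q ^ 2 - p ^ 2) + 1 ≤ Real.exp (-(q ^ 2 - p ^ 2)) := Real.add_one_le_exp _
    rw [hq, hEE]
    have h4 : E * E - E * E * Real.exp (-(q ^ 2 - p ^ 2)) ≤ E * E * ((q - p) * (q + p)) := by
      nlinarith [mul_pos hE0 hE0]
    have h5 : E * (q + p) ≤ 3 := by
      have : q + p ≤ 3 * (1 + p ^ 2 / 2) := by nlinarith [sq_nonneg (p - 1)]
      nlinarith
    calc _ ≤ E * E * ((q - p) * (q + p)) := h4
      _ = (E * (q + p)) * ((q - p) * E) := by ring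
      _ ≤ 3 * ((q - p) * E) := by gcongr
      _ = _ := by ring

lemma heatKernel_two_mul (d : ℕ) {t : ℝ} (ht : 0 < t) (x : Ed d) :
    (4 * π * t) ^ (-(d : ℝ) / 2) * Real.exp (-(‖x‖ / (2 * √t)) ^ 2 / 2) =
      2 ^ ((d : ℝ) / 2) * heatKernel d (2 * t) x := by
  unfold heatKernel
  rw [show 4 * π * (2 * t) = 2 * (4 * π * t) by ring,
    Real.mul_rpow (x := 2) (y := 4 * π * t) (by positivity) (by positivity), ← mul_assoc, ← mul_assoc,
    ← Real.rpow_add (by norm_num)]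
  have : (d : ℝ) / 2 + -(d : ℝ) / 2 = 0 := by ring
  rw [this, Real.rpow_zero, one_mul]
  congr 2
  rw [div_pow, mul_pow, Real.sq_sqrt ht.le]
  field_simp
  norm_num

lemma abs_heatKernel_sub_le (d : ℕ) {t : ℝ} (ht : 0 < t) (x x' : Ed d) :
    |heatKernel d t x - heatKernel d t x'| ≤
      kernelLipConst d / 2 / √t * ‖x - x'‖ *
        (heatKernel d (2 * t) x + heatKernel d (2 * t) x') := by
  wlog h : ‖x‖ ≤ ‖x'‖ generalizing x x'
  · have := this x' x (le_of_not_ge h)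
    rwa [abs_sub_comm, norm_sub_rev, add_comm (heatKernel d (2 * t) x')] at this
  have hst : 0 < √t := Real.sqrt_pos.2 ht
  have key := abs_exp_neg_sq_sub_le (p := ‖x‖ / (2 * √t)) (q := ‖x'‖ / (2 * √t))
    (by positivity) (by gcongr)
  have e : ∀ z : Ed d, heatKernel d t z =
      (4 * π * t) ^ (-(d : ℝ) / 2) * Real.exp (-(‖z‖ / (2 * √t)) ^ 2) := fun z => by
    unfold heatKernel
    rw [div_pow, mul_pow, Real.sq_sqrt ht.le]
    norm_num [neg_div]
  have hc : 0 ≤ (4 * π * t) ^ (-(d : ℝ) / 2) := by positivity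
  have hk := heatKernel_nonneg d (t := 2 * t) (by positivity) x'
  have hk0 := heatKernel_nonneg d (t := 2 * t) (by positivity) x
  have hn : ‖x'‖ - ‖x‖ ≤ ‖x - x'‖ := by rw [norm_sub_rev]; exact norm_sub_norm_le _ _
  rw [e, e, ← mul_sub, abs_mul, abs_of_nonneg hc]
  calc _ ≤ (4 * π * t) ^ (-(d : ℝ) / 2) *
        (3 * (‖x'‖ / (2 * √t) - ‖x‖ / (2 * √t)) * Real.exp (-(‖x‖ / (2 * √t)) ^ 2 / 2)) := by
          gcongr
    _ = 3 * ((‖x'‖ - ‖x‖) / (2 * √t)) *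
        ((4 * π * t) ^ (-(d : ℝ) / 2) * Real.exp (-(‖x‖ / (2 * √t)) ^ 2 / 2)) := by ring
    _ = kernelLipConst d / 2 / √t * (‖x'‖ - ‖x‖) * heatKernel d (2 * t) x := by
          rw [heatKernel_two_mul d ht]; unfold kernelLipConst; ring
    _ ≤ _ := by
          have := kernelLipConst_pos d
          gcongr
          linarith

section HeatConv

variable {d m : ℕ} {t s A : ℝ} {v : Ed d → Ed m}

lemma integrable_heatKernel_smul (ht : 0 < t) (hv : AEStronglyMeasurable v volume)
    (hA : ∀ᵐ y, ‖v y‖ ≤ A) (x : Ed d) :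
    Integrable fun y => heatKernel d t (x - y) • v y :=
  (integrable_heatKernel_sub d ht x).smul_bdd A hv hA

lemma norm_heatConv_le (ht : 0 < t) (hA : ∀ᵐ y, ‖v y‖ ≤ A) (x : Ed d) :
    ‖heatConv d t v x‖ ≤ A := by
  refine (norm_integral_le_of_norm_le ((integrable_heatKernel_sub d ht x).mul_const A) ?_).trans_eq
    (by rw [integral_mul_const, integral_heatKernel_sub d ht, one_mul])
  filter_upwards [hA] with y hy
  have := heatKernel_nonneg d ht (x - y)
  rw [norm_smul, Real.norm_of_nonneg this]
  gcongr

lemma heatConv_sub_const (ht : 0 < t) (hv : AEStronglyMeasurable v volume)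
    (hA : ∀ᵐ y, ‖v y‖ ≤ A) (P : Ed m) (x : Ed d) :
    heatConv d t (fun y => v y - P) x = heatConv d t v x - P := by
  unfold heatConv
  simp only [smul_sub]
  rw [integral_sub (integrable_heatKernel_smul ht hv hA x)
    ((integrable_heatKernel_sub d ht x).smul_const P), integral_smul_const,
    integral_heatKernel_sub d ht, one_smul]

lemma norm_heatConv_sub_le (ht : 0 < t) (hv : AEStronglyMeasurable v volume)
    (hA : ∀ᵐ y, ‖v y‖ ≤ A) (x x' : Ed d) :
    ‖heatConv d t v x - heatConv d t v x'‖ ≤ kernelLipConst d * A / √t * ‖x - x'‖ := by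
  have h2t : 0 < 2 * t := by positivity
  have hκ := kernelLipConst_pos d
  unfold heatConv
  rw [← integral_sub (integrable_heatKernel_smul ht hv hA x)
    (integrable_heatKernel_smul ht hv hA x')]
  refine (norm_integral_le_of_norm_le
    (g := fun y => kernelLipConst d / 2 / √t * ‖x - x'‖ * A *
      (heatKernel d (2 * t) (x - y) + heatKernel d (2 * t) (x' - y)))
    (((integrable_heatKernel_sub d h2t x).add (integrable_heatKernel_sub d h2t x')).const_mul _)
    ?_).trans_eq ?_
  · filter_upwards [hA] with y hy
    have h := abs_heatKernel_sub_le d ht (x - y) (x' - y)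
    rw [sub_sub_sub_cancel_right] at h
    rw [← sub_smul, norm_smul, Real.norm_eq_abs]
    have h1 := heatKernel_nonneg d h2t (x - y)
    have h2 := heatKernel_nonneg d h2t (x' - y)
    calc _ ≤ kernelLipConst d / 2 / √t * ‖x - x'‖ *
        (heatKernel d (2 * t) (x - y) + heatKernel d (2 * t) (x' - y)) * A := by gcongr
      _ = _ := by ring
  · rw [integral_const_mul, integral_add (integrable_heatKernel_sub d h2t x)
      (integrable_heatKernel_sub d h2t x'), integral_heatKernel_sub d h2t,
      integral_heatKernel_sub d h2t]
    ring

lemma heatConv_heatConv (ht : 0 < t) (hs : 0 < s) (hv : AEStronglyMeasurable v volume)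
    (hA : ∀ᵐ y, ‖v y‖ ≤ A) (x : Ed d) :
    heatConv d t (heatConv d s v) x = heatConv d (t + s) v x := by
  have hint : Integrable
      (fun p : Ed d × Ed d => (heatKernel d t (x - p.1) * heatKernel d s (p.1 - p.2)) • v p.2)
      (volume.prod volume) := by
    have hA' : ∀ᵐ p : Ed d × Ed d ∂(volume.prod volume), ‖v p.2‖ ≤ A :=
      Measure.quasiMeasurePreserving_snd.ae hA
    have hk : Integrable
        (fun p : Ed d × Ed d => heatKernel d t (x - p.1) * heatKernel d s (p.1 - p.2))
        (volume.prod volume) := by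
      have h1 := continuous_heatKernel d t
      have h2 := continuous_heatKernel d s
      refine (integrable_prod_iff (Continuous.aestronglyMeasurable (by fun_prop))).2 ⟨?_, ?_⟩
      · exact .of_forall fun y => (integrable_heatKernel_sub d hs y).const_mul (heatKernel d t (x - y))
      · have : ∀ y z, ‖heatKernel d t (x - y) * heatKernel d s (y - z)‖ =
            heatKernel d t (x - y) * heatKernel d s (y - z) := fun y z =>
          Real.norm_of_nonneg (mul_nonneg (heatKernel_nonneg d ht _) (heatKernel_nonneg d hs _))
        simp only [this, integral_const_mul, integral_heatKernel_sub d hs, mul_one]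
        exact integrable_heatKernel_sub d ht x
    exact hk.smul_bdd A hv.comp_snd hA'
  unfold heatConv
  simp only [← integral_smul, smul_smul]
  rw [integral_integral_swap hint]
  simp only [integral_smul_const, integral_heatKernel_mul_heatKernel d ht hs]

lemma lipschitzWith_of_norm_sub_le {L : ℝ} {w : Ed d → Ed m}
    (hw : ∀ x x', ‖w x - w x'‖ ≤ L * ‖x - x'‖) : LipschitzWith L.toNNReal w :=
  LipschitzWith.of_dist_le_mul fun x y => by
    rw [dist_eq_norm, dist_eq_norm]
    exact (hw x y).trans (by gcongr; exact Real.le_coe_toNNReal L)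

/-- A bounded Lipschitz map whose classical derivative is a.e. bounded by `K` becomes
`K`-Lipschitz under the heat flow. -/
lemma norm_heatConv_sub_le_of_fderiv {L K : ℝ} {w : Ed d → Ed m} (hs : 0 < s)
    (hw : ∀ x x', ‖w x - w x'‖ ≤ L * ‖x - x'‖) (hA : ∀ y, ‖w y‖ ≤ A)
    (hK : ∀ᵐ y, ‖fderiv ℝ w y‖ ≤ K) (x x' : Ed d) :
    ‖heatConv d s w x - heatConv d s w x'‖ ≤ K * ‖x - x'‖ := by
  have hLip := lipschitzWith_of_norm_sub_le hw
  have hcont : Continuous w := hLip.continuous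
  have hflip : ∀ x, heatConv d s w x = ∫ y, heatKernel d s y • w (x - y) := fun x => by
    unfold heatConv
    rw [← integral_sub_left_eq_self _ volume x]
    simp
  have hmeas : ∀ x : Ed d, AEStronglyMeasurable (fun y => heatKernel d s y • w (x - y)) volume :=
    fun x => by
      have := continuous_heatKernel d s
      exact Continuous.aestronglyMeasurable (by fun_prop)
  have hder : ∀ x, HasFDerivAt (fun x => ∫ y, heatKernel d s y • w (x - y))
      (∫ y, heatKernel d s y • fderiv ℝ w (x - y)) x := by
    intro x
    refine (hasFDerivAt_integral_of_dominated_loc_of_lip' (s := univ)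
      (bound := fun y => heatKernel d s y * L)
      Filter.univ_mem (fun x _ => hmeas x)
      ((integrable_heatKernel d hs).smul_bdd A
        (Continuous.aestronglyMeasurable (by fun_prop)) (.of_forall fun y => hA _)) ?_ ?_
      ((integrable_heatKernel d hs).mul_const L) ?_).2
    · have h1 : Measurable (fderiv ℝ w) := measurable_fderiv ℝ w
      exact ((continuous_heatKernel d s).measurable.smul
        (h1.comp (measurable_const.sub measurable_id))).aestronglyMeasurable
    · refine .of_forall fun y x' _ => ?_
      have := heatKernel_nonneg d hs y
      rw [← smul_sub, norm_smul, Real.norm_of_nonneg this, mul_assoc]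
      have h := hw (x' - y) (x - y)
      rw [sub_sub_sub_cancel_right] at h
      gcongr
    · have h := (quasiMeasurePreserving_sub_left (volume : Measure (Ed d)) x).ae
        (hLip.ae_differentiableAt (μ := volume))
      filter_upwards [h] with y hy
      have hd : HasFDerivAt (fun x => w (x - y)) (fderiv ℝ w (x - y)) x := by
        simpa [Function.comp_def] using
          hy.hasFDerivAt.comp x ((hasFDerivAt_id x).sub_const y)
      exact hd.const_smul (heatKernel d s y)
  have hKd : ∀ x, ‖∫ y, heatKernel d s y • fderiv ℝ w (x - y)‖ ≤ K := by
    intro x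
    refine (norm_integral_le_of_norm_le ((integrable_heatKernel d hs).mul_const K) ?_).trans_eq
      (by rw [integral_mul_const, integral_heatKernel d hs, one_mul])
    filter_upwards [(quasiMeasurePreserving_sub_left (volume : Measure (Ed d)) x).ae hK] with y hy
    have := heatKernel_nonneg d hs y
    rw [norm_smul, Real.norm_of_nonneg this]
    gcongr
  simp only [hflip]
  exact convex_univ.norm_image_sub_le_of_norm_hasFDerivWithin_le
    (fun z _ => (hder z).hasFDerivWithinAt) (fun z _ => hKd z) (mem_univ _) (mem_univ _)

end HeatConv

/-- The value of `∫₀ᵗ (t-s)^{-1/2} (1+s)^{-1} ds`. -/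
def singularIntegral (t : ℝ) : ℝ := 2 / √(1 + t) * Real.log (√(1 + t) + √t)

lemma hasDerivAt_singularIntegral_primitive {t s : ℝ} (hs : s ∈ Ioo 0 t) :
    HasDerivAt (fun s => 1 / √(1 + t) *
      (Real.log (√(1 + t) - √(t - s)) - Real.log (√(1 + t) + √(t - s))))
      (1 / √(t - s) * (1 / (1 + s))) s := by
  obtain ⟨h0, h1⟩ := hs
  have hr : 0 < √(t - s) := Real.sqrt_pos.2 (by linarith)
  have hrR : √(t - s) < √(1 + t) := Real.sqrt_lt_sqrt (by linarith) (by linarith)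
  have hr2 : √(t - s) ^ 2 = t - s := Real.sq_sqrt (by linarith)
  have hR2 : √(1 + t) ^ 2 = 1 + t := Real.sq_sqrt (by linarith)
  have hd : HasDerivAt (fun s => √(t - s)) (-1 / (2 * √(t - s))) s :=
    ((hasDerivAt_id s).const_sub t).sqrt (by simp only [id]; linarith)
  have hm : HasDerivAt (fun s => √(1 + t) - √(t - s)) (-(-1 / (2 * √(t - s)))) s :=
    hd.const_sub _
  have hp : HasDerivAt (fun s => √(1 + t) + √(t - s)) (-1 / (2 * √(t - s))) s :=
    hd.const_add _
  have h := ((hm.log (by linarith)).sub (hp.log (by linarith))).const_mul (1 / √(1 + t))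
  refine h.congr_deriv ?_
  have e1 : √(1 + t) - √(t - s) ≠ 0 := by linarith
  have e2 : √(1 + t) + √(t - s) ≠ 0 := by linarith
  have e3 : √(1 + t) ≠ 0 := by linarith
  have e4 : 1 + s = (√(1 + t) - √(t - s)) * (√(1 + t) + √(t - s)) := by
    linear_combination hr2 - hR2
  rw [e4]
  field_simp
  ring

lemma continuousOn_singularIntegral_primitive {t : ℝ} :
    ContinuousOn (fun s => 1 / √(1 + t) *
      (Real.log (√(1 + t) - √(t - s)) - Real.log (√(1 + t) + √(t - s)))) (Icc 0 t) := by
  have hlt : ∀ s ∈ Icc 0 t, √(t - s) < √(1 + t) := fun s hs =>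
    Real.sqrt_lt_sqrt (by linarith [hs.2]) (by linarith [hs.1])
  refine continuousOn_const.mul (ContinuousOn.sub ?_ ?_)
  · exact ContinuousOn.log (by fun_prop) fun s hs => by linarith [hlt s hs]
  · exact ContinuousOn.log (by fun_prop) fun s hs => by
      linarith [hlt s hs, Real.sqrt_nonneg (t - s)]

lemma integrableOn_singular {t : ℝ} :
    IntegrableOn (fun s => 1 / √(t - s) * (1 / (1 + s))) (Ioo 0 t) :=
  (intervalIntegral.integrableOn_deriv_of_nonneg continuousOn_singularIntegral_primitive
    (fun _ hs => hasDerivAt_singularIntegral_primitive hs)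
    (fun s hs => by have := hs.1; positivity)).mono_set Ioo_subset_Ioc_self

lemma integral_singular {t : ℝ} (ht : 0 < t) :
    ∫ s in Ioo 0 t, 1 / √(t - s) * (1 / (1 + s)) = singularIntegral t := by
  have hint : IntervalIntegrable (fun s => 1 / √(t - s) * (1 / (1 + s))) volume 0 t :=
    (intervalIntegrable_iff_integrableOn_Ioo_of_le ht.le).2 integrableOn_singular
  rw [← integral_Ioc_eq_integral_Ioo, ← intervalIntegral.integral_of_le ht.le,
    intervalIntegral.integral_eq_sub_of_hasDerivAt_of_le ht.le
      continuousOn_singularIntegral_primitive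
      (fun _ hs => hasDerivAt_singularIntegral_primitive hs) hint]
  have hlt : √t < √(1 + t) := Real.sqrt_lt_sqrt ht.le (by linarith)
  have hprod : (√(1 + t) - √t) * (√(1 + t) + √t) = 1 := by
    have h1 : √t ^ 2 = t := Real.sq_sqrt ht.le
    have h2 : √(1 + t) ^ 2 = 1 + t := Real.sq_sqrt (by linarith)
    linear_combination h2 - h1
  have hl : Real.log (√(1 + t) - √t) = -Real.log (√(1 + t) + √t) := by
    rw [← Real.log_inv, eq_inv_of_mul_eq_one_left hprod]
  simp only [sub_self, Real.sqrt_zero, sub_zero, add_zero, hl, singularIntegral]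
  ring

lemma integrableOn_one_div_one_add {t : ℝ} :
    IntegrableOn (fun s : ℝ => 1 / (1 + s)) (Ioo 0 t) := by
  refine (ContinuousOn.integrableOn_Icc (a := 0) (b := t) ?_).mono_set Ioo_subset_Icc_self
  exact ContinuousOn.div (by fun_prop) (by fun_prop) fun s hs => by linarith [hs.1]

lemma integral_one_div_one_add {t : ℝ} (ht : 0 < t) :
    ∫ s in Ioo 0 t, 1 / (1 + s) = Real.log (1 + t) := by
  rw [← integral_Ioc_eq_integral_Ioo, ← intervalIntegral.integral_of_le ht.le,
    intervalIntegral.integral_comp_add_left (fun s => 1 / s) 1,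
    integral_one_div_of_pos (by norm_num) (by linarith)]
  simp

lemma singularIntegral_le {t : ℝ} (ht : 0 < t) :
    singularIntegral t ≤ (2 + Real.log (1 + t)) / √(1 + t) := by
  have h1 : 0 < √(1 + t) := Real.sqrt_pos.2 (by linarith)
  have h2 : √t ≤ √(1 + t) := Real.sqrt_le_sqrt (by linarith)
  have h3 : Real.log (√(1 + t) + √t) ≤ Real.log 2 + Real.log (1 + t) / 2 := by
    rw [← Real.log_sqrt (by linarith), ← Real.log_mul (by norm_num) h1.ne']
    exact Real.log_le_log (by positivity) (by linarith)
  have h4 := Real.log_two_lt_d9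
  unfold singularIntegral
  rw [div_mul_eq_mul_div]
  gcongr
  linarith

lemma tendsto_singularIntegral : Tendsto singularIntegral (nhds 0) (nhds 0) := by
  have : ContinuousAt singularIntegral 0 := by
    unfold singularIntegral
    refine ContinuousAt.mul (ContinuousAt.div (by fun_prop) (by fun_prop) (by simp))
      (ContinuousAt.log (by fun_prop) (by simp))
  simpa [ContinuousAt, singularIntegral] using this

section Duhamel

variable {d m : ℕ} {t B : ℝ} {f : ℝ → Ed d → Ed m}

lemma integrableOn_heatConv (hf : Measurable (Function.uncurry f))
    (hfB : ∀ s ∈ Ioo 0 t, ∀ᵐ x, ‖f s x‖ ≤ B / (1 + s)) (x : Ed d) :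
    IntegrableOn (fun s => heatConv d (t - s) (f s) x) (Ioo 0 t) := by
  have hm : StronglyMeasurable fun s => heatConv d (t - s) (f s) x := by
    refine StronglyMeasurable.integral_prod_right
      (f := fun (s : ℝ) (y : Ed d) => heatKernel d (t - s) (x - y) • f s y)
      (Measurable.stronglyMeasurable ?_)
    refine Measurable.smul (f := fun p : ℝ × Ed d => heatKernel d (t - p.1) (x - p.2))
      (g := Function.uncurry f) ?_ hf
    exact (measurable_heatKernel_uncurry d).comp
      ((measurable_const.sub measurable_fst).prodMk (measurable_const.sub measurable_snd))
  refine Integrable.mono' (integrableOn_one_div_one_add.const_mul B) hm.aestronglyMeasurable ?_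
  filter_upwards [ae_restrict_mem measurableSet_Ioo] with s hs
  rw [mul_one_div]
  exact norm_heatConv_le (sub_pos.2 hs.2) (hfB s hs) x

lemma norm_duhamel_le (ht : 0 < t)
    (hfB : ∀ s ∈ Ioo 0 t, ∀ᵐ x, ‖f s x‖ ≤ B / (1 + s)) (x : Ed d) :
    ‖∫ s in Ioo 0 t, heatConv d (t - s) (f s) x‖ ≤ B * Real.log (1 + t) := by
  refine (norm_integral_le_of_norm_le (integrableOn_one_div_one_add.const_mul B) ?_).trans_eq
    (by rw [integral_const_mul, integral_one_div_one_add ht])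
  filter_upwards [ae_restrict_mem measurableSet_Ioo] with s hs
  rw [mul_one_div]
  exact norm_heatConv_le (sub_pos.2 hs.2) (hfB s hs) x

lemma norm_duhamel_sub_le (ht : 0 < t) (hf : Measurable (Function.uncurry f))
    (hfB : ∀ s ∈ Ioo 0 t, ∀ᵐ x, ‖f s x‖ ≤ B / (1 + s)) (x x' : Ed d) :
    ‖(∫ s in Ioo 0 t, heatConv d (t - s) (f s) x) -
        ∫ s in Ioo 0 t, heatConv d (t - s) (f s) x'‖ ≤
      kernelLipConst d * B * singularIntegral t * ‖x - x'‖ := by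
  rw [← integral_sub (integrableOn_heatConv hf hfB x) (integrableOn_heatConv hf hfB x')]
  refine (norm_integral_le_of_norm_le
    (integrableOn_singular.const_mul (kernelLipConst d * B * ‖x - x'‖)) ?_).trans_eq
    (by rw [integral_const_mul, integral_singular ht]; ring)
  filter_upwards [ae_restrict_mem measurableSet_Ioo] with s hs
  refine (norm_heatConv_sub_le (sub_pos.2 hs.2)
    (hf.comp measurable_prodMk_left).aestronglyMeasurable (hfB s hs) x x').trans_eq ?_
  ring

end Duhamel

section Norms

variable {d : ℕ} {F : Type*} [NormedAddCommGroup F] {g : Ed d → F}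

lemma ae_norm_le_of_eLpNorm_top_le {ε : ℝ} (hε : 0 ≤ ε)
    (h : eLpNorm g ⊤ volume ≤ ENNReal.ofReal ε) : ∀ᵐ x, ‖g x‖ ≤ ε := by
  rw [eLpNorm_exponent_top] at h
  filter_upwards [ae_le_eLpNormEssSup (f := g) (μ := volume)] with x hx
  have := hx.trans h
  rwa [← ofReal_norm, ENNReal.ofReal_le_ofReal_iff hε] at this

lemma ae_norm_le_of_weighted_eLpNorm_le {K s : ℝ} (hK : 0 ≤ K) (hs : 0 ≤ s)
    (h : ENNReal.ofReal ((1 + s) ^ ((1 : ℝ) / 2)) * eLpNorm g ⊤ volume ≤ ENNReal.ofReal K) :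
    ∀ᵐ x, ‖g x‖ ≤ K / √(1 + s) := by
  rw [← Real.sqrt_eq_rpow, eLpNorm_exponent_top] at h
  filter_upwards [ae_le_eLpNormEssSup (f := g) (μ := volume)] with x hx
  have h1 : ENNReal.ofReal √(1 + s) * ‖g x‖ₑ ≤ ENNReal.ofReal K :=
    (mul_le_mul_right hx _).trans h
  rw [← ofReal_norm, ← ENNReal.ofReal_mul (by positivity),
    ENNReal.ofReal_le_ofReal_iff hK] at h1
  rw [le_div_iff₀ (Real.sqrt_pos.2 (by linarith)), mul_comm]
  exact h1

lemma weighted_eLpNorm_le {K s : ℝ} (hs : 0 ≤ s) (h : ∀ x, ‖g x‖ ≤ K / √(1 + s)) :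
    ENNReal.ofReal ((1 + s) ^ ((1 : ℝ) / 2)) * eLpNorm g ⊤ volume ≤ ENNReal.ofReal K := by
  have h1 : 0 < √(1 + s) := Real.sqrt_pos.2 (by linarith)
  rw [← Real.sqrt_eq_rpow, eLpNorm_exponent_top]
  calc _ ≤ ENNReal.ofReal √(1 + s) * ENNReal.ofReal (K / √(1 + s)) := by
        gcongr
        exact eLpNormEssSup_le_of_ae_bound (.of_forall h)
    _ = _ := by
        rw [← ENNReal.ofReal_mul h1.le]
        congr 1
        field_simp

end Norms

lemma heatConv_eq_zero_of_not_aestronglyMeasurable {d m : ℕ} {t : ℝ} (ht : 0 < t)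
    {v : Ed d → Ed m} (hv : ¬ AEStronglyMeasurable v volume) (x : Ed d) :
    heatConv d t v x = 0 := by
  refine integral_non_aestronglyMeasurable fun h => hv ?_
  have hc : Continuous fun y => (heatKernel d t (x - y))⁻¹ := by
    have := continuous_heatKernel d t
    exact Continuous.inv₀ (by fun_prop) fun y => (heatKernel_pos d ht _).ne'
  refine (hc.aestronglyMeasurable.smul h).congr (.of_forall fun y => ?_)
  exact inv_smul_smul₀ (heatKernel_pos d ht (x - y)).ne' (v y)

/-- The linear evolution of the data of a mild solution is that of measurable data: if `u₀` is
not measurable, continuity of the norm at time zero forces `P` to be `ε`-small. -/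
lemma exists_aestronglyMeasurable_data {d m : ℕ} {ε B τ : ℝ} (hε : 0 ≤ ε) (hτ : 0 < τ)
    {P : Ed m} {u₀ : Ed d → Ed m} {u : ℝ → Ed d → Ed m}
    (hD : ∀ t ∈ Ioo 0 τ, ∀ x, ‖u t x - heatConv d t u₀ x‖ ≤ B * Real.log (1 + t))
    (h0 : eLpNorm (fun x => u₀ x - P) ⊤ volume ≤ ENNReal.ofReal ε) (hu0 : u 0 = u₀)
    (hN : ContinuousOn (fun t : ℝ => eLpNorm (fun x => u t x - P) ⊤ volume) (Ici 0)) :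
    ∃ v : Ed d → Ed m, AEStronglyMeasurable v volume ∧ (∀ᵐ y, ‖v y - P‖ ≤ ε) ∧
      ∀ t, 0 < t → ∀ x, heatConv d t u₀ x = heatConv d t v x := by
  by_cases hm : AEStronglyMeasurable u₀ volume
  · exact ⟨u₀, hm, ae_norm_le_of_eLpNorm_top_le hε h0, fun _ _ _ => rfl⟩
  refine ⟨fun _ => 0, aestronglyMeasurable_const, .of_forall fun y => ?_, fun t ht x => ?_⟩
  swap
  · rw [heatConv_eq_zero_of_not_aestronglyMeasurable ht hm]
    simp [heatConv]
  rw [zero_sub, norm_neg]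
  have hNt : Tendsto (fun t : ℝ => eLpNorm (fun x => u t x - P) ⊤ volume) (nhdsWithin 0 (Ioi 0))
      (nhds (eLpNorm (fun x => u₀ x - P) ⊤ volume)) := by
    have := (hN 0 (by simp)).tendsto
    rw [hu0] at this
    exact this.mono_left (nhdsWithin_mono _ Ioi_subset_Ici_self)
  have hL : Tendsto (fun t : ℝ => ENNReal.ofReal (B * Real.log (1 + t))) (nhdsWithin 0 (Ioi 0))
      (nhds 0) := by
    have : ContinuousAt (fun t : ℝ => B * Real.log (1 + t)) 0 :=
      continuousAt_const.mul (ContinuousAt.log (by fun_prop) (by simp))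
    have h := (ENNReal.continuous_ofReal.tendsto _).comp this.tendsto
    simp only [add_zero, Real.log_one, mul_zero, ENNReal.ofReal_zero] at h
    exact h.mono_left nhdsWithin_le_nhds
  have key : ENNReal.ofReal ‖P‖ ≤ eLpNorm (fun x => u₀ x - P) ⊤ volume + 0 := by
    refine ge_of_tendsto (hNt.add hL) ?_
    filter_upwards [Ioo_mem_nhdsGT hτ] with t ht
    obtain ⟨x, hx⟩ := (ae_le_eLpNormEssSup (f := fun x => u t x - P) (μ := volume)).exists
    have h1 := hD t ht x
    rw [heatConv_eq_zero_of_not_aestronglyMeasurable ht.1 hm, sub_zero] at h1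
    have h2 : ‖P‖ ≤ ‖u t x - P‖ + ‖u t x‖ := by
      rw [add_comm]; simpa using norm_sub_le (u t x) (u t x - P)
    calc ENNReal.ofReal ‖P‖ ≤ ENNReal.ofReal (‖u t x - P‖ + B * Real.log (1 + t)) :=
          ENNReal.ofReal_le_ofReal (by linarith)
      _ ≤ ENNReal.ofReal ‖u t x - P‖ + ENNReal.ofReal (B * Real.log (1 + t)) :=
          ENNReal.ofReal_add_le
      _ ≤ _ := by
          rw [eLpNorm_exponent_top, ofReal_norm]
          gcongr
  rw [add_zero] at key
  exact (ENNReal.ofReal_le_ofReal_iff hε).1 (key.trans h0)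

/-- The constant in the gradient bound for the linear evolution. -/
def linearGradConst (d : ℕ) : ℝ := 4 + 2 * kernelLipConst d

lemma linearGradConst_pos (d : ℕ) : 0 < linearGradConst d := by
  have := kernelLipConst_pos d
  unfold linearGradConst
  positivity

lemma norm_fderiv_heatConv_le_of_add {d m : ℕ} {K η A s : ℝ} (hs : 0 < s)
    {v D : Ed d → Ed m} (hv : AEStronglyMeasurable v volume) (hA : ∀ᵐ y, ‖v y‖ ≤ A)
    (hD : ∀ x x', ‖D x - D x'‖ ≤ η * ‖x - x'‖) (hη : 0 ≤ η)
    (hK : ∀ᵐ x, ‖fderiv ℝ (fun x => heatConv d s v x + D x) x‖ ≤ K) :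
    ∀ᵐ x, ‖fderiv ℝ (heatConv d s v) x‖ ≤ K + η := by
  have hw := lipschitzWith_of_norm_sub_le (norm_heatConv_sub_le hs hv hA)
  have hDL := lipschitzWith_of_norm_sub_le hD
  filter_upwards [hK, hw.ae_differentiableAt (μ := volume),
    hDL.ae_differentiableAt (μ := volume)] with x hx hwx hDx
  rw [fderiv_fun_add hwx hDx] at hx
  have h := norm_fderiv_le_of_lip' ℝ hη (.of_forall fun y => hD y x)
  calc ‖fderiv ℝ (heatConv d s v) x‖
      = ‖(fderiv ℝ (heatConv d s v) x + fderiv ℝ D x) - fderiv ℝ D x‖ := by simp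
    _ ≤ _ := (norm_sub_le _ _).trans (add_le_add hx h)

/-- If the weighted gradient of a mild solution is at most `K` up to time `t`, then the solution
and its gradient at time `t` are controlled by the data plus a term quadratic in `K`. -/
lemma mild_solution_apriori {d m : ℕ} {Λ ε K t : ℝ} (hΛ : 0 < Λ) (hε : 0 < ε) (hK : 0 ≤ K)
    (ht : 0 < t) {P : Ed m} {u₀ : Ed d → Ed m} {u : ℝ → Ed d → Ed m}
    (hu : IsMildSolution d m Λ u₀ u)
    (h0 : eLpNorm (fun x => u₀ x - P) ⊤ volume + eLpNorm (fun x => fderiv ℝ u₀ x) ⊤ volume ≤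
      ENNReal.ofReal ε)
    (hu0 : u 0 = u₀)
    (hN : ContinuousOn (fun t : ℝ => eLpNorm (fun x => u t x - P) ⊤ volume) (Ici 0))
    (hM : ContinuousOn (fun t : ℝ => ENNReal.ofReal ((1 + t) ^ ((1 : ℝ) / 2)) *
      eLpNorm (fun x => fderiv ℝ (u t) x) ⊤ volume) (Ici 0))
    (hMK : ∀ s ∈ Ioo 0 t, ENNReal.ofReal ((1 + s) ^ ((1 : ℝ) / 2)) *
      eLpNorm (fun x => fderiv ℝ (u s) x) ⊤ volume ≤ ENNReal.ofReal K) :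
    (∀ x, ‖u t x - P‖ ≤ ε + Λ * K ^ 2 * Real.log (1 + t)) ∧
    ∀ x, ‖fderiv ℝ (u t) x‖ ≤ (linearGradConst d * ε +
      kernelLipConst d * (Λ * K ^ 2) * (2 + Real.log (1 + t))) / √(1 + t) := by
  obtain ⟨f, hf, hfΛ, hmild⟩ := hu
  have hκ := kernelLipConst_pos d
  have hfB : ∀ s ∈ Ioo 0 t, ∀ᵐ x, ‖f s x‖ ≤ Λ * K ^ 2 / (1 + s) := by
    intro s hs
    filter_upwards [ae_norm_le_of_weighted_eLpNorm_le hK hs.1.le (hMK s hs)] with x hx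
    refine (hfΛ s hs.1 x).trans ?_
    have h1 : √(1 + s) ^ 2 = 1 + s := Real.sq_sqrt (by linarith [hs.1])
    calc _ ≤ Λ * (K / √(1 + s)) ^ 2 := by gcongr
      _ = _ := by rw [div_pow, h1]; ring
  have hB : 0 ≤ Λ * K ^ 2 := by positivity
  set B := Λ * K ^ 2 with hBdef
  have hfB' : ∀ r ∈ Ioc 0 t, ∀ s ∈ Ioo 0 r, ∀ᵐ x, ‖f s x‖ ≤ B / (1 + s) := fun r hr s hs =>
    hfB s ⟨hs.1, hs.2.trans_le hr.2⟩
  obtain ⟨v, hv, hvP, huv⟩ := exists_aestronglyMeasurable_data (τ := t) (B := B) hε.le ht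
    (fun r hr x => by
      rw [hmild r hr.1, add_sub_cancel_left]
      exact norm_duhamel_le hr.1 (hfB' r ⟨hr.1, hr.2.le⟩) x)
    (le_self_add.trans h0) hu0 hN
  have hvA : ∀ᵐ y, ‖v y‖ ≤ ε + ‖P‖ := by
    filter_upwards [hvP] with y hy
    have := norm_add_le (v y - P) P
    rw [sub_add_cancel] at this
    linarith
  have hut : ∀ r, 0 < r → u r = fun x => heatConv d r v x +
      ∫ s in Ioo 0 r, heatConv d (r - s) (f s) x := fun r hr => by
    ext1 x; rw [hmild r hr, huv r hr]
  have hlin0 : ∀ x, ‖heatConv d t v x - P‖ ≤ ε := fun x => by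
    rw [← heatConv_sub_const ht hv hvA]
    exact norm_heatConv_le ht hvP x
  have hlin1 : ∀ x x', ‖heatConv d t v x - heatConv d t v x'‖ ≤
      kernelLipConst d * ε / √t * ‖x - x'‖ := fun x x' => by
    have := norm_heatConv_sub_le (v := fun y => v y - P) ht
      (hv.sub aestronglyMeasurable_const) hvP x x'
    rwa [heatConv_sub_const ht hv hvA, heatConv_sub_const ht hv hvA,
      sub_sub_sub_cancel_right] at this
  have hlin2 : ∀ x x', ‖heatConv d t v x - heatConv d t v x'‖ ≤ 2 * ε * ‖x - x'‖ := by
    have hMt : Tendsto (fun t : ℝ => ENNReal.ofReal ((1 + t) ^ ((1 : ℝ) / 2)) *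
        eLpNorm (fun x => fderiv ℝ (u t) x) ⊤ volume) (nhdsWithin 0 (Ioi 0))
        (nhds (eLpNorm (fun x => fderiv ℝ u₀ x) ⊤ volume)) := by
      have := (hM 0 (by simp)).tendsto
      simp only [hu0, add_zero, Real.one_rpow, ENNReal.ofReal_one, one_mul] at this
      exact this.mono_left (nhdsWithin_mono _ Ioi_subset_Ici_self)
    have hlt : eLpNorm (fun x => fderiv ℝ u₀ x) ⊤ volume < ENNReal.ofReal (3 / 2 * ε) :=
      (le_add_self.trans h0).trans_lt
        ((ENNReal.ofReal_lt_ofReal_iff (by positivity)).2 (by linarith))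
    have hJ : Tendsto (fun r => kernelLipConst d * B * singularIntegral r)
        (nhdsWithin 0 (Ioi 0)) (nhds 0) := by
      simpa using (tendsto_singularIntegral.mono_left nhdsWithin_le_nhds).const_mul
        (kernelLipConst d * B)
    obtain ⟨δ, ⟨hδM, hδJ⟩, hδ⟩ := ((hMt.eventually (gt_mem_nhds hlt)).and
      (hJ.eventually (gt_mem_nhds (half_pos hε)))).and (Ioo_mem_nhdsGT ht) |>.exists
    have hD : ∀ x x', ‖(∫ s in Ioo 0 δ, heatConv d (δ - s) (f s) x) -
        ∫ s in Ioo 0 δ, heatConv d (δ - s) (f s) x'‖ ≤ ε / 2 * ‖x - x'‖ := fun x x' =>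
      (norm_duhamel_sub_le hδ.1 hf (hfB' δ ⟨hδ.1, hδ.2.le⟩) x x').trans (by gcongr)
    have hδu : ∀ᵐ x, ‖fderiv ℝ (u δ) x‖ ≤ 3 / 2 * ε := by
      filter_upwards [ae_norm_le_of_weighted_eLpNorm_le (by positivity) hδ.1.le hδM.le] with x hx
      refine hx.trans (div_le_self (by positivity) ?_)
      rw [Real.one_le_sqrt]
      linarith [hδ.1]
    rw [hut δ hδ.1] at hδu
    have hw := norm_fderiv_heatConv_le_of_add hδ.1 hv hvA hD (by positivity) hδu
    intro x x'
    have h := norm_heatConv_sub_le_of_fderiv (sub_pos.2 hδ.2)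
      (norm_heatConv_sub_le hδ.1 hv hvA) (norm_heatConv_le hδ.1 hvA) hw x x'
    rw [heatConv_heatConv (sub_pos.2 hδ.2) hδ.1 hv hvA,
      heatConv_heatConv (sub_pos.2 hδ.2) hδ.1 hv hvA, sub_add_cancel] at h
    exact h.trans_eq (by ring)
  have hsq : 0 < √(1 + t) := Real.sqrt_pos.2 (by linarith)
  have hlin : ∀ x x', ‖heatConv d t v x - heatConv d t v x'‖ ≤
      linearGradConst d * ε / √(1 + t) * ‖x - x'‖ := by
    intro x x'
    rcases le_total t 1 with h1 | h1
    · refine (hlin2 x x').trans ?_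
      gcongr
      rw [le_div_iff₀ hsq]
      have : √(1 + t) ≤ 2 := Real.sqrt_le_iff.2 ⟨by norm_num, by linarith⟩
      unfold linearGradConst
      nlinarith [mul_pos hκ hε]
    · refine (hlin1 x x').trans ?_
      have hst : 0 < √t := Real.sqrt_pos.2 ht
      refine mul_le_mul_of_nonneg_right ?_ (norm_nonneg _)
      rw [div_le_div_iff₀ hst hsq]
      have : √(1 + t) ≤ 2 * √t := by
        rw [Real.sqrt_le_left (by positivity), mul_pow, Real.sq_sqrt ht.le]
        linarith
      unfold linearGradConst
      have h2 := mul_le_mul_of_nonneg_left this (mul_pos hκ hε).le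
      nlinarith [mul_pos hε hst]
  constructor
  · intro x
    have h1 := norm_duhamel_le ht hfB x
    rw [hut t ht]
    calc _ = ‖(heatConv d t v x - P) + ∫ s in Ioo 0 t, heatConv d (t - s) (f s) x‖ := by
          rw [add_sub_right_comm]
      _ ≤ _ := (norm_add_le _ _).trans (add_le_add (hlin0 x) h1)
  · intro x
    have hlog : 0 ≤ Real.log (1 + t) := Real.log_nonneg (by linarith)
    have hA := linearGradConst_pos d
    refine norm_fderiv_le_of_lip' ℝ (by positivity) (.of_forall fun y => ?_)
    have h1 := norm_duhamel_sub_le ht hf hfB y x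
    have h2 := singularIntegral_le ht
    rw [hut t ht]
    calc _ = ‖(heatConv d t v y - heatConv d t v x) +
          ((∫ s in Ioo 0 t, heatConv d (t - s) (f s) y) -
            ∫ s in Ioo 0 t, heatConv d (t - s) (f s) x)‖ := by
          rw [add_sub_add_comm]
      _ ≤ linearGradConst d * ε / √(1 + t) * ‖y - x‖ +
          kernelLipConst d * B * singularIntegral t * ‖y - x‖ :=
          (norm_add_le _ _).trans (add_le_add (hlin y x) h1)
      _ ≤ linearGradConst d * ε / √(1 + t) * ‖y - x‖ +
          kernelLipConst d * B * ((2 + Real.log (1 + t)) / √(1 + t)) * ‖y - x‖ := by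
          gcongr
      _ = _ := by ring

/-- stability on exponentially long time scales: for data `ε`-close to a
constant `P` in `W^{1,∞}`, the solution stays `C`-bounded (with `t^{-1/2}` gradient decay)
up to time `exp(b/ε) - 1`. -/
theorem exponentially_long_stability (d m : ℕ) (hd : 1 ≤ d) (hm : 1 ≤ m)
    (Λ : ℝ) (hΛ : 0 < Λ) (C : ℝ) (hC : 0 < C) :
    ∃ b ε₀ : ℝ, 0 < b ∧ 0 < ε₀ ∧
      ∀ ε : ℝ, ε ∈ Set.Ioo 0 ε₀ →
        ∀ (P : Ed m) (u₀ : Ed d → Ed m) (u : ℝ → Ed d → Ed m),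
          IsMildSolution d m Λ u₀ u →
          eLpNorm (fun x => u₀ x - P) ⊤ volume +
              eLpNorm (fun x => fderiv ℝ u₀ x) ⊤ volume ≤ ENNReal.ofReal ε →
          u 0 = u₀ →
          ContinuousOn (fun t : ℝ => eLpNorm (fun x => u t x - P) ⊤ volume) (Set.Ici 0) →
          ContinuousOn
            (fun t : ℝ =>
              ENNReal.ofReal ((1 + t) ^ ((1 : ℝ) / 2)) *
                eLpNorm (fun x => fderiv ℝ (u t) x) ⊤ volume) (Set.Ici 0) →
          (⨆ t : Set.Icc (0 : ℝ) (Real.exp (b / ε) - 1),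
              eLpNorm (fun x => u (t : ℝ) x - P) ⊤ volume) +
            (⨆ t : Set.Icc (0 : ℝ) (Real.exp (b / ε) - 1),
              ENNReal.ofReal ((1 + (t : ℝ)) ^ ((1 : ℝ) / 2)) *
                eLpNorm (fun x => fderiv ℝ (u (t : ℝ)) x) ⊤ volume) ≤
            ENNReal.ofReal C := by
  set κ := kernelLipConst d with hκdef
  set A := linearGradConst d with hAdef
  have hκ : 0 < κ := kernelLipConst_pos d
  have hA : 0 < A := linearGradConst_pos d
  set b : ℝ := 1 / (16 * κ * Λ * A) with hb
  have hb0 : 0 < b := by positivity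
  have hbmul : κ * Λ * A * b = 1 / 16 := by rw [hb]; field_simp
  set Q : ℝ := 1 + 4 * Λ * A ^ 2 * b + 2 * A with hQ
  have hQ0 : 0 < Q := by positivity
  refine ⟨b, min b (C / Q), hb0, by positivity, ?_⟩
  rintro ε ⟨hε, hεlt⟩ P u₀ u hu h0 hu0 hN hM
  have hεb : ε < b := hεlt.trans_le (min_le_left _ _)
  have hεC : ε * Q < C := (lt_div_iff₀ hQ0).1 (hεlt.trans_le (min_le_right _ _))
  set K := 2 * A * ε with hK
  have hK0 : 0 < K := by positivity
  have hlog : ∀ t ∈ Icc (0 : ℝ) (Real.exp (b / ε) - 1), Real.log (1 + t) ≤ b / ε := by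
    intro t ht
    rw [Real.log_le_iff_le_exp (by linarith [ht.1])]
    linarith [ht.2]
  have hKsq : Λ * K ^ 2 * (b / ε) = 4 * Λ * A ^ 2 * b * ε := by rw [hK]; field_simp; ring
  have hclose : A * ε + κ * (Λ * K ^ 2) * (2 + b / ε) < K := by
    have e : κ * (Λ * K ^ 2) * (2 + b / ε) =
        8 * (κ * Λ * A) * ε * (A * ε) + 4 * (κ * Λ * A * b) * (A * ε) := by
      rw [hK]; field_simp; ring
    have h1 : κ * Λ * A * ε ≤ κ * Λ * A * b := by gcongr
    have h2 : 0 < A * ε := by positivity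
    rw [e, hbmul, hK]
    rw [hbmul] at h1
    nlinarith
  set M : ℝ → ℝ≥0∞ := fun t => ENNReal.ofReal ((1 + t) ^ ((1 : ℝ) / 2)) *
    eLpNorm (fun x => fderiv ℝ (u t) x) ⊤ volume with hMdef
  have hM0 : M 0 < ENNReal.ofReal K := by
    simp only [hMdef, hu0, add_zero, Real.one_rpow, ENNReal.ofReal_one, one_mul]
    refine (le_add_self.trans h0).trans_lt ((ENNReal.ofReal_lt_ofReal_iff hK0).2 ?_)
    have : 4 ≤ A := by rw [hAdef, linearGradConst]; linarith
    rw [hK]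
    nlinarith
  have hMK : ∀ t ∈ Icc (0 : ℝ) (Real.exp (b / ε) - 1), M t ≤ ENNReal.ofReal K := by
    by_contra! hcon
    obtain ⟨t₁, ht₁, hMt₁⟩ := hcon
    have hclosed : IsClosed (Icc 0 t₁ ∩ M ⁻¹' Ici (ENNReal.ofReal K)) :=
      (hM.mono Icc_subset_Ici_self).preimage_isClosed_of_isClosed isClosed_Icc isClosed_Ici
    obtain ⟨t, ⟨⟨ht0, htt₁⟩, htK⟩, hmin⟩ :=
      (isCompact_Icc.of_isClosed_subset hclosed inter_subset_left).exists_isLeast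
        ⟨t₁, ⟨ht₁.1, le_rfl⟩, hMt₁.le⟩
    have htpos : 0 < t := by
      refine ht0.lt_of_ne fun h => ?_
      rw [← h] at htK
      exact (hM0.trans_le htK).false
    have hbelow : ∀ s ∈ Ioo 0 t, M s ≤ ENNReal.ofReal K := by
      intro s hs
      by_contra! hs'
      exact (hmin ⟨⟨hs.1.le, hs.2.le.trans htt₁⟩, hs'.le⟩).not_gt hs.2
    have h := (mild_solution_apriori hΛ hε hK0.le htpos hu h0 hu0 hN hM hbelow).2
    have hle : M t ≤ ENNReal.ofReal (A * ε + κ * (Λ * K ^ 2) * (2 + Real.log (1 + t))) :=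
      weighted_eLpNorm_le ht0 h
    have hlogt := hlog t ⟨ht0, htt₁.trans ht₁.2⟩
    have hlt : A * ε + κ * (Λ * K ^ 2) * (2 + Real.log (1 + t)) < K :=
      lt_of_le_of_lt (by gcongr) hclose
    exact ((hle.trans_lt ((ENNReal.ofReal_lt_ofReal_iff hK0).2 hlt)).trans_le htK).false
  have hNK : ∀ t ∈ Icc (0 : ℝ) (Real.exp (b / ε) - 1),
      eLpNorm (fun x => u t x - P) ⊤ volume ≤ ENNReal.ofReal (ε + 4 * Λ * A ^ 2 * b * ε) := by
    intro t ht
    rcases ht.1.eq_or_lt with h | htpos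
    · rw [← h, hu0]
      exact (le_self_add.trans h0).trans (ENNReal.ofReal_le_ofReal (by
        have : 0 ≤ 4 * Λ * A ^ 2 * b * ε := by positivity
        linarith))
    · have h := (mild_solution_apriori hΛ hε hK0.le htpos hu h0 hu0 hN hM
        fun s hs => hMK s ⟨hs.1.le, hs.2.le.trans ht.2⟩).1
      rw [eLpNorm_exponent_top]
      refine eLpNormEssSup_le_of_ae_bound (.of_forall fun x => (h x).trans ?_)
      rw [← hKsq]
      have := hlog t ht
      gcongr
  refine le_trans (add_le_add (iSup_le fun t => hNK t t.2) (iSup_le fun t => hMK t t.2)) ?_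
  calc ENNReal.ofReal (ε + 4 * Λ * A ^ 2 * b * ε) + ENNReal.ofReal K
      = ENNReal.ofReal (ε + 4 * Λ * A ^ 2 * b * ε + K) :=
        (ENNReal.ofReal_add (by positivity) hK0.le).symm
    _ ≤ ENNReal.ofReal C := ENNReal.ofReal_le_ofReal (by
        rw [hK]
        have : ε * Q = ε + 4 * Λ * A ^ 2 * b * ε + 2 * A * ε := by rw [hQ]; ring
        linarith)
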